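/- For every pair of open sets Ω₀ ⋐ Ω ⊆ ℝ (Ω₀ with compact closure contained in Ω) there exists a constant C > 0 such that for every positive integer N there is a function φ ∈ C_c^∞(Ω) with 0 ≤ φ ≤ 1, φ ≡ 1 on Ω₀, and |φ^{(j)}(x)| ≤ C^{j+1} N^j for all 0 ≤ j ≤ N and all x ∈ ℝ. -/

import Mathlib

open scoped ContDiff Manifold

/-- The average of `g` over the interval `[x - h, x + h]`. -/
noncomputable def boxAverage (h : ℝ) (g : ℝ → ℝ) (x : ℝ) : ℝ :=
  (2 * h)⁻¹ * ∫ t in (x - h)..(x + h), g t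

lemma hasDerivAt_boxAverage {g : ℝ → ℝ} (hg : Continuous g) (h x : ℝ) :
    HasDerivAt (boxAverage h g) ((2 * h)⁻¹ * (g (x + h) - g (x - h))) x := by
  have key (a : ℝ) : HasDerivAt (fun y ↦ ∫ t in (0 : ℝ)..(y + a), g t) (g (x + a)) x :=
    (intervalIntegral.integral_hasDerivAt_right (hg.intervalIntegrable _ _)
      hg.stronglyMeasurable.stronglyMeasurableAtFilter hg.continuousAt).comp_add_const x a
  have heq : boxAverage h g = fun y ↦ (2 * h)⁻¹ *
      ((∫ t in (0 : ℝ)..(y + h), g t) - ∫ t in (0 : ℝ)..(y + -h), g t) := by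
    funext y
    rw [intervalIntegral.integral_interval_sub_left (hg.intervalIntegrable _ _)
      (hg.intervalIntegrable _ _), boxAverage, sub_eq_add_neg]
  rw [heq, sub_eq_add_neg x h]
  exact ((key h).sub (key (-h))).const_mul _

lemma deriv_boxAverage {g : ℝ → ℝ} (hg : Continuous g) (h : ℝ) :
    deriv (boxAverage h g) = fun x ↦ (2 * h)⁻¹ * (g (x + h) - g (x - h)) :=
  funext fun x ↦ (hasDerivAt_boxAverage hg h x).deriv

lemma contDiff_boxAverage {g : ℝ → ℝ} (hg : ContDiff ℝ ∞ g) (h : ℝ) :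
    ContDiff ℝ ∞ (boxAverage h g) := by
  rw [contDiff_infty_iff_deriv, deriv_boxAverage hg.continuous]
  refine ⟨fun x ↦ (hasDerivAt_boxAverage hg.continuous h x).differentiableAt, ?_⟩
  fun_prop

lemma abs_iteratedDeriv_succ_boxAverage_le {g : ℝ → ℝ} (hg : ContDiff ℝ ∞ g) {h M : ℝ}
    (hh : 0 < h) {j : ℕ} (hM : ∀ x, |iteratedDeriv j g x| ≤ M) (x : ℝ) :
    |iteratedDeriv (j + 1) (boxAverage h g) x| ≤ h⁻¹ * M := by
  have hj : ContDiff ℝ j g := hg.of_le (by exact_mod_cast le_top)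
  have h1 : ContDiff ℝ j (fun z ↦ g (z + h)) := by fun_prop
  have h2 : ContDiff ℝ j (fun z ↦ g (z - h)) := by fun_prop
  have hsub := iteratedDeriv_sub (x := x) h1.contDiffAt h2.contDiffAt
  rw [iteratedDeriv_comp_add_const, iteratedDeriv_comp_sub_const] at hsub
  rw [iteratedDeriv_succ', deriv_boxAverage hg.continuous, iteratedDeriv_const_mul_field]
  change |_ * iteratedDeriv j ((fun z ↦ g (z + h)) - fun z ↦ g (z - h)) x| ≤ _
  rw [hsub, abs_mul, abs_of_pos (by positivity)]
  calc (2 * h)⁻¹ * |iteratedDeriv j g (x + h) - iteratedDeriv j g (x - h)|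
      ≤ (2 * h)⁻¹ * (M + M) := by
        gcongr
        exact (abs_sub _ _).trans (add_le_add (hM _) (hM _))
    _ = h⁻¹ * M := by field_simp; ring

lemma boxAverage_eq_of_eqOn {g : ℝ → ℝ} {h c x : ℝ} (hh : 0 < h)
    (hc : ∀ t, |t - x| ≤ h → g t = c) : boxAverage h g x = c := by
  have : ∫ t in (x - h)..(x + h), g t = ∫ _ in (x - h)..(x + h), c := by
    refine intervalIntegral.integral_congr fun t ht ↦ hc t ?_
    rw [Set.uIcc_of_le (by linarith)] at ht
    rw [abs_le]
    constructor <;> linarith [ht.1, ht.2]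
  rw [boxAverage, this, intervalIntegral.integral_const, smul_eq_mul]
  field_simp
  ring

lemma boxAverage_mono {f g : ℝ → ℝ} (hf : Continuous f) (hg : Continuous g) {h : ℝ}
    (hh : 0 < h) (hfg : ∀ t, f t ≤ g t) (x : ℝ) : boxAverage h f x ≤ boxAverage h g x :=
  mul_le_mul_of_nonneg_left
    (intervalIntegral.integral_mono (by linarith) (hf.intervalIntegrable _ _)
      (hg.intervalIntegrable _ _) hfg) (by positivity)

/-- Averaging a smooth function with values in `[0, 1]` over intervals of radius `h`, `k` times in
a row, moves values by at most `k * h` and bounds the first `k` derivatives by powers of `h⁻¹`. -/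
lemma exists_smooth_abs_iteratedDeriv_le {χ : ℝ → ℝ} (hχ : ContDiff ℝ ∞ χ)
    (hχ01 : ∀ x, 0 ≤ χ x ∧ χ x ≤ 1) {h : ℝ} (hh : 0 < h) (k : ℕ) :
    ∃ g : ℝ → ℝ, ContDiff ℝ ∞ g ∧ (∀ x, 0 ≤ g x ∧ g x ≤ 1) ∧
      (∀ c x, (∀ y, |y - x| ≤ k * h → χ y = c) → g x = c) ∧
      ∀ j ≤ k, ∀ x, |iteratedDeriv j g x| ≤ h⁻¹ ^ j := by
  induction k with
  | zero =>
    refine ⟨χ, hχ, hχ01, fun c x hc ↦ hc x (by simp), fun j hj x ↦ ?_⟩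
    obtain rfl : j = 0 := by omega
    simpa [abs_le] using ⟨by linarith [(hχ01 x).1], (hχ01 x).2⟩
  | succ k ih =>
    obtain ⟨g, hg, hg01, hgc, hgd⟩ := ih
    have h01 (x : ℝ) : 0 ≤ boxAverage h g x ∧ boxAverage h g x ≤ 1 := by
      constructor
      · calc (0 : ℝ) = boxAverage h (fun _ ↦ 0) x := (boxAverage_eq_of_eqOn hh fun _ _ ↦ rfl).symm
          _ ≤ _ := boxAverage_mono continuous_const hg.continuous hh (fun t ↦ (hg01 t).1) x
      · calc boxAverage h g x ≤ boxAverage h (fun _ ↦ 1) x :=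
              boxAverage_mono hg.continuous continuous_const hh (fun t ↦ (hg01 t).2) x
          _ = 1 := boxAverage_eq_of_eqOn hh fun _ _ ↦ rfl
    refine ⟨boxAverage h g, contDiff_boxAverage hg h, h01, fun c x hc ↦ ?_, fun j hj x ↦ ?_⟩
    · refine boxAverage_eq_of_eqOn hh fun t ht ↦ hgc c t fun y hy ↦ hc y ?_
      push_cast
      linarith [abs_sub_le y t x]
    · cases j with
      | zero => simpa [abs_le] using ⟨by linarith [(h01 x).1], (h01 x).2⟩
      | succ j =>
        rw [pow_succ']
        exact abs_iteratedDeriv_succ_boxAverage_le hg hh (hgd j (by omega)) x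

/-- Existence of Ehrenpreis–Hörmander cutoff functions: for `Ω₀ ⋐ Ω ⊆ ℝ` there
is a constant `C` such that for each `N` there is `φ ∈ C_c^∞(Ω)`, `0 ≤ φ ≤ 1`,
`φ ≡ 1` on `Ω₀`, with `|φ^{(j)}| ≤ C^{j+1} N^j` for all `j ≤ N`. -/
theorem stmt_18 (Ω₀ Ω : Set ℝ) (h₀ : IsOpen Ω₀) (h : IsOpen Ω)
    (hcpt : IsCompact (closure Ω₀)) (hsub : closure Ω₀ ⊆ Ω) :
    ∃ C : ℝ, 0 < C ∧ ∀ N : ℕ, 0 < N →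
      ∃ φ : ℝ → ℝ, ContDiff ℝ (⊤ : ℕ∞) φ ∧ HasCompactSupport φ ∧ tsupport φ ⊆ Ω ∧
        (∀ x, 0 ≤ φ x ∧ φ x ≤ 1) ∧ (∀ x ∈ Ω₀, φ x = 1) ∧
        ∀ j : ℕ, j ≤ N → ∀ x : ℝ,
          |iteratedDeriv j φ x| ≤ C ^ (j + 1) * (N : ℝ) ^ j := by
  obtain ⟨ε, hε, hεsub⟩ := hcpt.exists_cthickening_subset_open h hsub
  set K := closure Ω₀
  set δ := ε / 3 with hδε
  have hδ : 0 < δ := by positivity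
  have hdisj : Disjoint (Metric.thickening (2 * δ) K)ᶜ (Metric.cthickening δ K) :=
    Set.disjoint_compl_left_iff_subset.2
      (Metric.cthickening_subset_thickening' (by positivity) (by linarith) K)
  obtain ⟨χ, hχ0, hχ1, hχ01⟩ := exists_contMDiffMap_zero_one_of_isClosed (n := ⊤) 𝓘(ℝ, ℝ)
    Metric.isOpen_thickening.isClosed_compl Metric.isClosed_cthickening hdisj
  refine ⟨max 1 δ⁻¹, by positivity, fun N hN ↦ ?_⟩
  have hN' : (0 : ℝ) < N := by exact_mod_cast hN
  obtain ⟨φ, hφ, hφ01, hφc, hφd⟩ := exists_smooth_abs_iteratedDeriv_le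
    χ.contMDiff.contDiff hχ01 (div_pos hδ hN') N
  rw [mul_div_cancel₀ _ hN'.ne'] at hφc
  have hsupp : tsupport φ ⊆ Metric.cthickening ε K := by
    refine closure_minimal (fun x hx ↦ ?_) Metric.isClosed_cthickening
    by_contra hxK
    refine hx (hφc 0 x fun y hy ↦ hχ0 fun hyK ↦ hxK ?_)
    obtain ⟨z, hz, hyz⟩ := Metric.mem_thickening_iff.1 hyK
    refine Metric.mem_cthickening_of_dist_le x z ε K hz ?_
    rw [← Real.dist_eq] at hy
    linarith [dist_triangle_left x z y]
  refine ⟨φ, hφ, hcpt.cthickening.of_isClosed_subset (isClosed_tsupport φ) hsupp,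
    hsupp.trans hεsub, hφ01, fun x hx ↦ hφc 1 x fun y hy ↦ hχ1 ?_, fun j hj x ↦ ?_⟩
  · exact Metric.mem_cthickening_of_dist_le y x δ K (subset_closure hx) (by rwa [Real.dist_eq])
  · calc |iteratedDeriv j φ x| ≤ (δ / N)⁻¹ ^ j := hφd j hj x
      _ = δ⁻¹ ^ j * (N : ℝ) ^ j := by rw [← mul_pow, inv_div, div_eq_mul_inv, mul_comm]
      _ ≤ (max 1 δ⁻¹) ^ (j + 1) * (N : ℝ) ^ j := by
        gcongr
        calc δ⁻¹ ^ j ≤ (max 1 δ⁻¹) ^ j := by gcongr; exact le_max_right _ _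
          _ ≤ (max 1 δ⁻¹) ^ (j + 1) := pow_le_pow_right₀ (le_max_left _ _) (by omega)
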